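/- arXiv:2512.23670 — 4 statements merged into one kernel-verified Lean document; each statement's English description precedes it below -/
import Mathlib

section
/- Let T > 0 and let x, y : [0,T] → ℝ^d be continuously differentiable paths. Then the double series k(s,t) := ∑_{k=0}^∞ ∑_{w ∈ {1,…,d}^k} Sig^w(x)_{0,s} · Sig^w(y)_{0,t} converges absolutely for every (s,t) ∈ [0,T]², defines a bounded continuous function k : [0,T]² → ℝ, and k is the unique bounded continuous solution of the Goursat–Volterra equation with kernel q(u,v) = ⟨ẋ_u, ẏ_v⟩, i.e., k(s,t) = 1 + ∫₀^s ∫₀^t ⟨ẋ_u, ẏ_v⟩ k(u,v) dv du for all (s,t) ∈ [0,T]². -/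
open MeasureTheory Set Matrix

/-- The signature coordinate `Sig^w(x)_{s,t}` of a path with derivative `x'`,
for a word `w` with letters in `Fin d`:
`Sig^{(i₁,…,i_k)}(x)_{s,t} = ∫_{s<u₁<⋯<u_k<t} ẋ^{i₁}(u₁)⋯ẋ^{i_k}(u_k) du₁⋯du_k`,
with `Sig^∅(x)_{s,t} = 1`. -/
noncomputable def sigCoord {d : ℕ} (x' : ℝ → Fin d → ℝ) : List (Fin d) → ℝ → ℝ → ℝ
  | [], _, _ => 1
  | i :: w, s, t => ∫ u in s..t, x' u i * sigCoord x' w u t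

/-- A bounded continuous function `k` on `[0,T]²` solves the Goursat–Volterra equation
with kernel `q` if `k(s,t) = 1 + ∫₀^s ∫₀^t q(u,v) k(u,v) dv du` on `[0,T]²`. -/
def IsGoursatSolution (T : ℝ) (q k : ℝ → ℝ → ℝ) : Prop :=
  ContinuousOn (fun p : ℝ × ℝ => k p.1 p.2) (Icc 0 T ×ˢ Icc 0 T) ∧
  (∃ C : ℝ, ∀ s ∈ Icc (0 : ℝ) T, ∀ t ∈ Icc (0 : ℝ) T, |k s t| ≤ C) ∧
  ∀ s ∈ Icc (0 : ℝ) T, ∀ t ∈ Icc (0 : ℝ) T,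
    k s t = 1 + ∫ u in (0 : ℝ)..s, ∫ v in (0 : ℝ)..t, q u v * k u v

/-- Fubini's theorem on the triangle `s < u < v < t`. -/
theorem integral_integral_triangle_swap {f : ℝ → ℝ → ℝ} (hf : Continuous f.uncurry)
    {s t : ℝ} (hst : s ≤ t) :
    ∫ u in s..t, ∫ v in u..t, f u v = ∫ v in s..t, ∫ u in s..v, f u v := by
  have hmeas : MeasurableSet {p : ℝ × ℝ | p.1 < p.2} :=
    measurableSet_lt measurable_fst measurable_snd
  have hint : IntegrableOn (Function.uncurry fun u v => (Ioi u).indicator (f u) v)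
      (uIoc s t ×ˢ uIoc s t) := by
    have hsquare : IntegrableOn f.uncurry (uIoc s t ×ˢ uIoc s t) :=
      (hf.continuousOn.integrableOn_compact
        ((isCompact_uIcc (a := s) (b := t)).prod (isCompact_uIcc (a := s) (b := t)))).mono_set
        (prod_mono uIoc_subset_uIcc uIoc_subset_uIcc)
    exact hsquare.indicator hmeas
  calc ∫ u in s..t, ∫ v in u..t, f u v
      = ∫ u in s..t, ∫ v in s..t, (Ioi u).indicator (f u) v := by
        refine intervalIntegral.integral_congr fun u hu => ?_
        rw [uIcc_of_le hst] at hu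
        simp only [intervalIntegral.integral_of_le hst, intervalIntegral.integral_of_le hu.2]
        rw [setIntegral_indicator measurableSet_Ioi, Ioc_inter_Ioi, sup_eq_right.2 hu.1]
    _ = ∫ v in s..t, ∫ u in s..t, (Ioi u).indicator (f u) v :=
        intervalIntegral_intervalIntegral_swap hint
    _ = ∫ v in s..t, ∫ u in s..v, f u v := by
        refine intervalIntegral.integral_congr fun v hv => ?_
        rw [uIcc_of_le hst] at hv
        have hind : (fun u => (Ioi u).indicator (f u) v) = (Iio v).indicator fun u => f u v := by
          ext u
          simp [indicator_apply]
        have hset : Ioc s t ∩ Iio v = Ioo s v := by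
          ext u
          simp only [mem_inter_iff, mem_Ioc, mem_Iio, mem_Ioo]
          exact ⟨fun h => ⟨h.1.1, h.2⟩, fun h => ⟨⟨h.1, h.2.le.trans hv.2⟩, h.2⟩⟩
        simp only [intervalIntegral.integral_of_le hst, intervalIntegral.integral_of_le hv.1, hind]
        rw [setIntegral_indicator measurableSet_Iio, hset, integral_Ioc_eq_integral_Ioo]

theorem continuous_sigCoord {d : ℕ} {X : ℝ → Fin d → ℝ} (hX : Continuous X) (w : List (Fin d)) :
    Continuous fun p : ℝ × ℝ => sigCoord X w p.1 p.2 := by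
  induction w with
  | nil => simpa only [sigCoord] using continuous_const
  | cons i w ih =>
    have hint : Continuous (Function.uncurry fun (p : ℝ × ℝ) u =>
        X u i * sigCoord X w u p.2) :=
      ((continuous_apply i).comp (hX.comp continuous_snd)).mul
        (ih.comp (continuous_snd.prodMk (continuous_snd.comp continuous_fst)))
    have hsplit : ∀ p : ℝ × ℝ, sigCoord X (i :: w) p.1 p.2 =
        (∫ u in (0 : ℝ)..p.2, X u i * sigCoord X w u p.2) -
          ∫ u in (0 : ℝ)..p.1, X u i * sigCoord X w u p.2 := by
      intro p
      have hp : Continuous fun u => X u i * sigCoord X w u p.2 :=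
        hint.comp (continuous_const.prodMk continuous_id)
      rw [sigCoord, intervalIntegral.integral_interval_sub_left]
      exacts [hp.intervalIntegrable _ _, hp.intervalIntegrable _ _]
    simp only [hsplit]
    exact (intervalIntegral.continuous_parametric_intervalIntegral_of_continuous hint
      continuous_snd).sub
      (intervalIntegral.continuous_parametric_intervalIntegral_of_continuous hint continuous_fst)

/-- Chen's recursion on the last letter of a word. -/
theorem sigCoord_concat {d : ℕ} {X : ℝ → Fin d → ℝ} (hX : Continuous X) (w : List (Fin d))
    (j : Fin d) {s t : ℝ} (hst : s ≤ t) :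
    sigCoord X (w ++ [j]) s t = ∫ v in s..t, sigCoord X w s v * X v j := by
  induction w generalizing s with
  | nil => simp [sigCoord]
  | cons i w ih =>
    have hcont : Continuous (Function.uncurry fun u v =>
        X u i * (sigCoord X w u v * X v j)) :=
      ((continuous_apply i).comp (hX.comp continuous_fst)).mul
        ((continuous_sigCoord hX w).mul ((continuous_apply j).comp (hX.comp continuous_snd)))
    calc sigCoord X (i :: w ++ [j]) s t
        = ∫ u in s..t, ∫ v in u..t, X u i * (sigCoord X w u v * X v j) := by
          rw [List.cons_append, sigCoord]
          refine intervalIntegral.integral_congr fun u hu => ?_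
          rw [uIcc_of_le hst] at hu
          simp only [ih hu.2, intervalIntegral.integral_const_mul]
      _ = ∫ v in s..t, ∫ u in s..v, X u i * (sigCoord X w u v * X v j) :=
          integral_integral_triangle_swap hcont hst
      _ = ∫ v in s..t, sigCoord X (i :: w) s v * X v j := by
          refine intervalIntegral.integral_congr fun v _ => ?_
          simp only [sigCoord, ← mul_assoc, intervalIntegral.integral_mul_const]

theorem sigCoord_congr {d : ℕ} {X Z : ℝ → Fin d → ℝ} {T : ℝ} (h : EqOn X Z (Icc 0 T))
    (w : List (Fin d)) {s t : ℝ} (hs : 0 ≤ s) (hst : s ≤ t) (ht : t ≤ T) :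
    sigCoord X w s t = sigCoord Z w s t := by
  induction w generalizing s with
  | nil => simp [sigCoord]
  | cons i w ih =>
    rw [sigCoord, sigCoord]
    refine intervalIntegral.integral_congr fun u hu => ?_
    rw [uIcc_of_le hst] at hu
    simp only [ih (hs.trans hu.1) hu.2, h ⟨hs.trans hu.1, hu.2.trans ht⟩]

theorem abs_integral_le_mul_pow_div_factorial {f : ℝ → ℝ} {M t : ℝ} {n : ℕ} (ht : 0 ≤ t)
    (hf : ∀ u, 0 ≤ u → u ≤ t → |f u| ≤ M * (u ^ n / n.factorial)) :
    |∫ u in (0 : ℝ)..t, f u| ≤ M * (t ^ (n + 1) / (n + 1).factorial) := by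
  have hcont : Continuous fun u : ℝ => M * (u ^ n / n.factorial) := by fun_prop
  calc |∫ u in (0 : ℝ)..t, f u|
      ≤ ∫ u in (0 : ℝ)..t, M * (u ^ n / n.factorial) := by
        rw [← Real.norm_eq_abs]
        exact intervalIntegral.norm_integral_le_of_norm_le ht
          (.of_forall fun u hu => hf u hu.1.le hu.2) (hcont.intervalIntegrable _ _)
    _ = M * (t ^ (n + 1) / (n + 1).factorial) := by
        rw [intervalIntegral.integral_const_mul, intervalIntegral.integral_div, integral_pow,
          Nat.factorial_succ]
        push_cast
        field_simp
        simp

theorem abs_sigCoord_le {d : ℕ} {X : ℝ → Fin d → ℝ} (hX : Continuous X) {M T : ℝ}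
    (hM : ∀ u ∈ Icc 0 T, ∀ i, |X u i| ≤ M) (w : List (Fin d)) {t : ℝ} (ht : t ∈ Icc 0 T) :
    |sigCoord X w 0 t| ≤ M ^ w.length * (t ^ w.length / w.length.factorial) := by
  induction w using List.reverseRecOn generalizing t with
  | nil => simp [sigCoord]
  | append_singleton w j ih =>
    rw [sigCoord_concat hX w j ht.1, List.length_append, List.length_singleton]
    refine abs_integral_le_mul_pow_div_factorial ht.1 fun u hu hut => ?_
    have hu' : u ∈ Icc 0 T := ⟨hu, hut.trans ht.2⟩
    rw [abs_mul, pow_succ, mul_right_comm]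
    exact mul_le_mul (ih hu') (hM u hu' j) (abs_nonneg _) ((abs_nonneg _).trans (ih hu'))

/-- The level-`n` part of the signature kernel. -/
noncomputable def sigKernelLevel {d : ℕ} (X Y : ℝ → Fin d → ℝ) (n : ℕ) (s t : ℝ) : ℝ :=
  ∑ w : Fin n → Fin d, sigCoord X (List.ofFn w) 0 s * sigCoord Y (List.ofFn w) 0 t

theorem continuous_sigKernelLevel {d : ℕ} {X Y : ℝ → Fin d → ℝ} (hX : Continuous X)
    (hY : Continuous Y) (n : ℕ) :
    Continuous fun p : ℝ × ℝ => sigKernelLevel X Y n p.1 p.2 :=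
  continuous_finsetSum _ fun w _ =>
    ((continuous_sigCoord hX (List.ofFn w)).comp (continuous_const.prodMk continuous_fst)).mul
      ((continuous_sigCoord hY (List.ofFn w)).comp (continuous_const.prodMk continuous_snd))

theorem sigKernelLevel_succ {d : ℕ} {X Y : ℝ → Fin d → ℝ} (hX : Continuous X)
    (hY : Continuous Y) (n : ℕ) {s t : ℝ} (hs : 0 ≤ s) (ht : 0 ≤ t) :
    sigKernelLevel X Y (n + 1) s t =
      ∫ u in (0 : ℝ)..s, ∫ v in (0 : ℝ)..t, (X u ⬝ᵥ Y v) * sigKernelLevel X Y n u v := by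
  have hcont : ∀ {Z : ℝ → Fin d → ℝ}, Continuous Z → ∀ p : Fin d × (Fin n → Fin d),
      Continuous fun u => sigCoord Z (List.ofFn p.2) 0 u * Z u p.1 := fun hZ p =>
    ((continuous_sigCoord hZ (List.ofFn p.2)).comp (continuous_const.prodMk continuous_id)).mul
      ((continuous_apply p.1).comp hZ)
  have hlast : ∀ {Z : ℝ → Fin d → ℝ}, Continuous Z → ∀ p : Fin d × (Fin n → Fin d),
      ∀ {r : ℝ}, 0 ≤ r → sigCoord Z (List.ofFn (Fin.snocEquiv (fun _ => Fin d) p)) 0 r =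
        ∫ u in (0 : ℝ)..r, sigCoord Z (List.ofFn p.2) 0 u * Z u p.1 := by
    intro Z hZ p r hr
    rw [List.ofFn_succ', List.concat_eq_append, ← sigCoord_concat hZ _ _ hr]
    simp [Fin.snocEquiv]
  have hexpand : ∀ u v, (X u ⬝ᵥ Y v) * sigKernelLevel X Y n u v =
      ∑ p : Fin d × (Fin n → Fin d), (sigCoord X (List.ofFn p.2) 0 u * X u p.1) *
        (sigCoord Y (List.ofFn p.2) 0 v * Y v p.1) := by
    intro u v
    rw [sigKernelLevel, dotProduct, Finset.sum_mul_sum, ← Finset.univ_product_univ,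
      Finset.sum_product]
    exact Finset.sum_congr rfl fun j _ => Finset.sum_congr rfl fun w _ => by ring
  simp only [hexpand]
  rw [sigKernelLevel, ← (Fin.snocEquiv fun _ => Fin d).sum_comp]
  have hinner : ∀ u, ∫ v in (0 : ℝ)..t, ∑ p : Fin d × (Fin n → Fin d),
      (sigCoord X (List.ofFn p.2) 0 u * X u p.1) *
        (sigCoord Y (List.ofFn p.2) 0 v * Y v p.1) =
      ∑ p : Fin d × (Fin n → Fin d), (sigCoord X (List.ofFn p.2) 0 u * X u p.1) *
        ∫ v in (0 : ℝ)..t, sigCoord Y (List.ofFn p.2) 0 v * Y v p.1 := by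
    intro u
    rw [intervalIntegral.integral_finsetSum fun p _ =>
      ((hcont hY p).const_mul _).intervalIntegrable _ _]
    exact Finset.sum_congr rfl fun p _ => intervalIntegral.integral_const_mul _ _
  simp only [hinner]
  rw [intervalIntegral.integral_finsetSum fun p _ =>
    ((hcont hX p).mul_const _).intervalIntegrable _ _]
  refine Finset.sum_congr rfl fun p _ => ?_
  rw [intervalIntegral.integral_mul_const, hlast hX p hs, hlast hY p ht]

theorem sum_abs_sigCoord_mul_le {d : ℕ} {X Y : ℝ → Fin d → ℝ} (hX : Continuous X)
    (hY : Continuous Y) {M T : ℝ} (hXM : ∀ u ∈ Icc 0 T, ∀ i, |X u i| ≤ M)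
    (hYM : ∀ u ∈ Icc 0 T, ∀ i, |Y u i| ≤ M) (hM : 0 ≤ M) (n : ℕ) {s t : ℝ}
    (hs : s ∈ Icc 0 T) (ht : t ∈ Icc 0 T) :
    ∑ w : Fin n → Fin d, |sigCoord X (List.ofFn w) 0 s * sigCoord Y (List.ofFn w) 0 t| ≤
      (d * (M * T) ^ 2) ^ n / n.factorial := by
  have hT : 0 ≤ T := hs.1.trans hs.2
  have hbound : ∀ {Z : ℝ → Fin d → ℝ}, Continuous Z → (∀ u ∈ Icc 0 T, ∀ i, |Z u i| ≤ M) →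
      ∀ (w : Fin n → Fin d) {r : ℝ}, r ∈ Icc 0 T →
        |sigCoord Z (List.ofFn w) 0 r| ≤ (M * T) ^ n / n.factorial := by
    intro Z hZ hZM w r hr
    have h := abs_sigCoord_le hZ hZM (List.ofFn w) hr
    rw [List.length_ofFn] at h
    rw [mul_pow, mul_div_assoc]
    refine h.trans ?_
    have := hr.1
    have := hr.2
    gcongr
  have hfac : (1 : ℝ) ≤ n.factorial := by exact_mod_cast n.factorial_pos
  calc ∑ w : Fin n → Fin d, |sigCoord X (List.ofFn w) 0 s * sigCoord Y (List.ofFn w) 0 t|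
      ≤ ∑ _w : Fin n → Fin d, (M * T) ^ n / n.factorial * (M * T) ^ n := by
        refine Finset.sum_le_sum fun w _ => ?_
        rw [abs_mul]
        exact mul_le_mul (hbound hX hXM w hs)
          ((hbound hY hYM w ht).trans (div_le_self (by positivity) hfac))
          (abs_nonneg _) (by positivity)
    _ = (d * (M * T) ^ 2) ^ n / n.factorial := by
        simp only [Finset.sum_const, Finset.card_univ, Fintype.card_fun, Fintype.card_fin,
          nsmul_eq_mul]
        push_cast
        ring

/-- Integration of a uniformly dominated series of continuous kernels over a rectangle. -/
theorem integral_integral_tsum {T : ℝ} {F : ℕ → ℝ → ℝ → ℝ} {c : ℕ → ℝ}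
    (hF : ∀ n, Continuous (F n).uncurry) (hc : Summable c)
    (hFc : ∀ n, ∀ u ∈ Icc 0 T, ∀ v ∈ Icc 0 T, |F n u v| ≤ c n)
    {s t : ℝ} (hs : s ∈ Icc 0 T) (ht : t ∈ Icc 0 T) :
    ∑' n, ∫ u in (0 : ℝ)..s, ∫ v in (0 : ℝ)..t, F n u v =
      ∫ u in (0 : ℝ)..s, ∫ v in (0 : ℝ)..t, ∑' n, F n u v := by
  have hmem : ∀ {r}, r ∈ Icc 0 T → ∀ {u}, u ∈ uIoc 0 r → u ∈ Icc 0 T := by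
    intro r hr u hu
    rw [uIoc_of_le hr.1] at hu
    exact ⟨hu.1.le, hu.2.trans hr.2⟩
  refine (intervalIntegral.hasSum_integral_of_dominated_convergence (fun n _ => c n * |t - 0|)
    (fun n => ?_) (fun n => .of_forall fun u hu => ?_) (.of_forall fun _ _ => hc.mul_right _)
    intervalIntegrable_const (.of_forall fun u hu => ?_)).tsum_eq
  · exact (intervalIntegral.continuous_parametric_intervalIntegral_of_continuous'
      (hF n) 0 t).aestronglyMeasurable
  · exact intervalIntegral.norm_integral_le_of_norm_le_const fun v hv =>
      hFc n u (hmem hs hu) v (hmem ht hv)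
  · refine intervalIntegral.hasSum_integral_of_dominated_convergence (fun n _ => c n)
      (fun n => ?_) (fun n => .of_forall fun v hv => hFc n u (hmem hs hu) v (hmem ht hv))
      (.of_forall fun _ _ => hc) intervalIntegrable_const (.of_forall fun v hv => ?_)
    · exact ((hF n).comp (continuous_const.prodMk continuous_id)).aestronglyMeasurable
    · exact (Summable.of_norm_bounded hc fun n => hFc n u (hmem hs hu) v (hmem ht hv)).hasSum

/-- The homogeneous Goursat–Volterra equation has only the trivial bounded solution. -/
theorem eq_zero_of_homogeneous_goursat {T : ℝ} {q D : ℝ → ℝ → ℝ} {Q C : ℝ}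
    (hq : ∀ u ∈ Icc 0 T, ∀ v ∈ Icc 0 T, |q u v| ≤ Q)
    (hD : ∀ u ∈ Icc 0 T, ∀ v ∈ Icc 0 T, |D u v| ≤ C)
    (heq : ∀ s ∈ Icc 0 T, ∀ t ∈ Icc 0 T,
      D s t = ∫ u in (0 : ℝ)..s, ∫ v in (0 : ℝ)..t, q u v * D u v)
    {s t : ℝ} (hs : s ∈ Icc 0 T) (ht : t ∈ Icc 0 T) : D s t = 0 := by
  have hiter : ∀ n : ℕ, ∀ s ∈ Icc 0 T, ∀ t ∈ Icc 0 T,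
      |D s t| ≤ C * Q ^ n * (t ^ n / n.factorial) * (s ^ n / n.factorial) := by
    intro n
    induction n with
    | zero => simpa using hD
    | succ n ih =>
      intro s hs t ht
      rw [heq s hs t ht]
      refine abs_integral_le_mul_pow_div_factorial hs.1 fun u hu hus => ?_
      have hu' : u ∈ Icc 0 T := ⟨hu, hus.trans hs.2⟩
      rw [mul_right_comm]
      refine abs_integral_le_mul_pow_div_factorial ht.1 fun v hv hvt => ?_
      have hv' : v ∈ Icc 0 T := ⟨hv, hvt.trans ht.2⟩
      rw [abs_mul]
      calc |q u v| * |D u v|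
          ≤ Q * (C * Q ^ n * (v ^ n / n.factorial) * (u ^ n / n.factorial)) :=
            mul_le_mul (hq u hu' v hv') (ih u hu' v hv') (abs_nonneg _)
              ((abs_nonneg _).trans (hq u hu' v hv'))
        _ = _ := by ring
  have hlim : Filter.Tendsto
      (fun n : ℕ => C * ((Q * t) ^ n / n.factorial) * (s ^ n / n.factorial)) Filter.atTop
      (nhds (C * 0 * 0)) :=
    ((FloorSemiring.tendsto_pow_div_factorial_atTop (Q * t)).const_mul C).mul
      (FloorSemiring.tendsto_pow_div_factorial_atTop s)
  refine abs_nonpos_iff.1 (ge_of_tendsto' (by simpa using hlim) fun n => ?_)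
  refine (hiter n s hs t ht).trans_eq ?_
  rw [mul_pow]
  ring

/-- Bounded continuous solutions of the Goursat–Volterra equation are unique. -/
theorem IsGoursatSolution.unique {T : ℝ} {q k₁ k₂ : ℝ → ℝ → ℝ}
    (hqc : ContinuousOn q.uncurry (Icc 0 T ×ˢ Icc 0 T))
    (h₁ : IsGoursatSolution T q k₁) (h₂ : IsGoursatSolution T q k₂)
    {s t : ℝ} (hs : s ∈ Icc 0 T) (ht : t ∈ Icc 0 T) : k₁ s t = k₂ s t := by
  obtain ⟨hc₁, ⟨C₁, hC₁⟩, he₁⟩ := h₁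
  obtain ⟨hc₂, ⟨C₂, hC₂⟩, he₂⟩ := h₂
  obtain ⟨Q, hQ⟩ := (isCompact_Icc.prod isCompact_Icc).exists_bound_of_continuousOn hqc
  have hsub : ∀ {r}, r ∈ Icc 0 T → uIcc 0 r ⊆ Icc 0 T := fun hr => by
    rw [uIcc_of_le hr.1]
    exact Icc_subset_Icc_right hr.2
  have hinner : ∀ {k : ℝ → ℝ → ℝ},
      ContinuousOn (fun p : ℝ × ℝ => k p.1 p.2) (Icc 0 T ×ˢ Icc 0 T) →
      ∀ u ∈ Icc 0 T, ∀ t ∈ Icc 0 T,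
        IntervalIntegrable (fun v => q u v * k u v) volume 0 t := by
    intro k hk u hu t ht
    refine ((hqc.mul hk).comp (f := fun v => (u, v)) (by fun_prop)
      fun v hv => ⟨hu, hsub ht hv⟩).intervalIntegrable
  have houter : ∀ {k : ℝ → ℝ → ℝ},
      ContinuousOn (fun p : ℝ × ℝ => k p.1 p.2) (Icc 0 T ×ˢ Icc 0 T) →
      ∀ s ∈ Icc 0 T, ∀ t ∈ Icc 0 T,
        IntervalIntegrable (fun u => ∫ v in (0 : ℝ)..t, q u v * k u v) volume 0 s := by
    intro k hk s hs t ht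
    have hT : 0 ≤ T := hs.1.trans hs.2
    let π : ℝ → ℝ := fun u => projIcc 0 T hT u
    have hπ : Continuous π := continuous_subtype_val.comp continuous_projIcc
    have hπ_mem : ∀ u, π u ∈ Icc 0 T := fun u => (projIcc 0 T hT u).2
    have hπ_eq : ∀ u ∈ Icc 0 T, π u = u := fun u hu => by simp [π, projIcc_of_mem hT hu]
    have hext : Continuous (Function.uncurry fun u v => q (π u) (π v) * k (π u) (π v)) :=
      (hqc.mul hk).comp_continuous
        ((hπ.comp continuous_fst).prodMk (hπ.comp continuous_snd))
        fun p => ⟨hπ_mem p.1, hπ_mem p.2⟩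
    have hprim : Continuous fun u => ∫ v in (0 : ℝ)..t, q (π u) (π v) * k (π u) (π v) :=
      intervalIntegral.continuous_parametric_intervalIntegral_of_continuous' hext 0 t
    refine (hprim.continuousOn.congr fun u hu => ?_).intervalIntegrable
    refine intervalIntegral.integral_congr fun v hv => ?_
    simp only [hπ_eq u (hsub hs hu), hπ_eq v (hsub ht hv)]
  refine sub_eq_zero.1 (eq_zero_of_homogeneous_goursat (q := q) (Q := Q) (C := C₁ + C₂)
    (D := fun u v => k₁ u v - k₂ u v) (fun u hu v hv => hQ (u, v) ⟨hu, hv⟩)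
    (fun u hu v hv => (abs_sub _ _).trans (add_le_add (hC₁ u hu v hv) (hC₂ u hu v hv)))
    (fun s hs t ht => ?_) hs ht)
  rw [he₁ s hs t ht, he₂ s hs t ht, add_sub_add_left_eq_sub,
    ← intervalIntegral.integral_sub (houter hc₁ s hs t ht) (houter hc₂ s hs t ht)]
  refine intervalIntegral.integral_congr fun u hu => ?_
  have hu' := hsub hs hu
  simp only [mul_sub]
  rw [intervalIntegral.integral_sub (hinner hc₁ u hu' t ht) (hinner hc₂ u hu' t ht)]

theorem isGoursatSolution_sigKernel {d : ℕ} {X Y : ℝ → Fin d → ℝ} (hX : Continuous X)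
    (hY : Continuous Y) {M T : ℝ} (hXM : ∀ u ∈ Icc 0 T, ∀ i, |X u i| ≤ M)
    (hYM : ∀ u ∈ Icc 0 T, ∀ i, |Y u i| ≤ M) (hM : 0 ≤ M) :
    IsGoursatSolution T (fun u v => X u ⬝ᵥ Y v) fun s t => ∑' n, sigKernelLevel X Y n s t := by
  set c : ℕ → ℝ := fun n => (d * (M * T) ^ 2) ^ n / n.factorial
  have hc : Summable c := Real.summable_pow_div_factorial _
  have hbound : ∀ n, ∀ s ∈ Icc 0 T, ∀ t ∈ Icc 0 T, |sigKernelLevel X Y n s t| ≤ c n :=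
    fun n s hs t ht => (Finset.abs_sum_le_sum_abs _ _).trans
      (sum_abs_sigCoord_mul_le hX hY hXM hYM hM n hs ht)
  have hq : Continuous (Function.uncurry fun u v => X u ⬝ᵥ Y v) :=
    (hX.comp continuous_fst).dotProduct (hY.comp continuous_snd)
  refine ⟨?_, ⟨∑' n, c n, fun s hs t ht => ?_⟩, fun s hs t ht => ?_⟩
  · exact continuousOn_tsum (fun n => (continuous_sigKernelLevel hX hY n).continuousOn) hc
      fun n p hp => hbound n p.1 hp.1 p.2 hp.2
  · rw [← Real.norm_eq_abs]
    exact tsum_of_norm_bounded hc.hasSum fun n => hbound n s hs t ht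
  · obtain ⟨Q, hQ⟩ := (isCompact_Icc.prod isCompact_Icc).exists_bound_of_continuousOn
      (hq.continuousOn (s := Icc 0 T ×ˢ Icc 0 T))
    have hsum : Summable fun n => sigKernelLevel X Y n s t :=
      Summable.of_norm_bounded hc fun n => hbound n s hs t ht
    have hzero : sigKernelLevel X Y 0 s t = 1 := by simp [sigKernelLevel, sigCoord]
    beta_reduce
    rw [hsum.tsum_eq_zero_add, hzero]
    simp only [sigKernelLevel_succ hX hY _ hs.1 ht.1, ← tsum_mul_left]
    rw [integral_integral_tsum (T := T) (c := fun n => Q * c n)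
      (F := fun n u v => (X u ⬝ᵥ Y v) * sigKernelLevel X Y n u v)
      (fun n => hq.mul (continuous_sigKernelLevel hX hY n)) (hc.mul_left Q) ?_ hs ht]
    intro n u hu v hv
    rw [abs_mul]
    exact mul_le_mul (hQ (u, v) ⟨hu, hv⟩) (hbound n u hu v hv) (abs_nonneg _)
      ((norm_nonneg _).trans (hQ (u, v) ⟨hu, hv⟩))

theorem IsGoursatSolution.congr {T : ℝ} {q₁ q₂ k₁ k₂ : ℝ → ℝ → ℝ}
    (h : IsGoursatSolution T q₁ k₁)
    (hq : ∀ s ∈ Icc 0 T, ∀ t ∈ Icc 0 T, q₂ s t = q₁ s t)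
    (hk : ∀ s ∈ Icc 0 T, ∀ t ∈ Icc 0 T, k₂ s t = k₁ s t) : IsGoursatSolution T q₂ k₂ := by
  obtain ⟨hc, ⟨C, hC⟩, he⟩ := h
  refine ⟨hc.congr fun p hp => hk p.1 hp.1 p.2 hp.2,
    ⟨C, fun s hs t ht => by rw [hk s hs t ht]; exact hC s hs t ht⟩, fun s hs t ht => ?_⟩
  rw [hk s hs t ht, he s hs t ht]
  congr 1
  refine intervalIntegral.integral_congr fun u hu => intervalIntegral.integral_congr fun v hv => ?_
  rw [uIcc_of_le hs.1] at hu
  rw [uIcc_of_le ht.1] at hv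
  have hu' : u ∈ Icc 0 T := ⟨hu.1, hu.2.trans hs.2⟩
  have hv' : v ∈ Icc 0 T := ⟨hv.1, hv.2.trans ht.2⟩
  simp only [hq u hu' v hv', hk u hu' v hv']

/-- For continuously differentiable paths `x, y : [0,T] → ℝ^d`, the double
series `k(s,t) = ∑_k ∑_{w ∈ {1,…,d}^k} Sig^w(x)_{0,s} Sig^w(y)_{0,t}` converges absolutely for
every `(s,t) ∈ [0,T]²`, defines a bounded continuous function on `[0,T]²`, and is the unique
bounded continuous solution of the Goursat–Volterra equation with kernel `q(u,v) = ⟨ẋ_u, ẏ_v⟩`. -/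
theorem stmt0 {T : ℝ} (hT : 0 < T) {d : ℕ} (x y x' y' : ℝ → Fin d → ℝ)
    (hx : ∀ u ∈ Icc (0 : ℝ) T, HasDerivAt x (x' u) u)
    (hy : ∀ u ∈ Icc (0 : ℝ) T, HasDerivAt y (y' u) u)
    (hx' : ContinuousOn x' (Icc 0 T)) (hy' : ContinuousOn y' (Icc 0 T)) :
    (∀ s ∈ Icc (0 : ℝ) T, ∀ t ∈ Icc (0 : ℝ) T,
      Summable (fun k : ℕ => ∑ w : Fin k → Fin d,
        |sigCoord x' (List.ofFn w) 0 s * sigCoord y' (List.ofFn w) 0 t|)) ∧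
    IsGoursatSolution T (fun u v => x' u ⬝ᵥ y' v)
      (fun s t => ∑' k : ℕ, ∑ w : Fin k → Fin d,
        sigCoord x' (List.ofFn w) 0 s * sigCoord y' (List.ofFn w) 0 t) ∧
    (∀ k₂ : ℝ → ℝ → ℝ, IsGoursatSolution T (fun u v => x' u ⬝ᵥ y' v) k₂ →
      ∀ s ∈ Icc (0 : ℝ) T, ∀ t ∈ Icc (0 : ℝ) T,
        k₂ s t = ∑' k : ℕ, ∑ w : Fin k → Fin d,
          sigCoord x' (List.ofFn w) 0 s * sigCoord y' (List.ofFn w) 0 t) := by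
  have hTle : (0 : ℝ) ≤ T := hT.le
  obtain ⟨X, hX, hXx⟩ : ∃ X : ℝ → Fin d → ℝ, Continuous X ∧ EqOn X x' (Icc 0 T) :=
    ⟨IccExtend hTle ((Icc 0 T).domRestrict x'), hx'.domRestrict.Icc_extend',
      fun u hu => IccExtend_of_mem hTle _ hu⟩
  obtain ⟨Y, hY, hYy⟩ : ∃ Y : ℝ → Fin d → ℝ, Continuous Y ∧ EqOn Y y' (Icc 0 T) :=
    ⟨IccExtend hTle ((Icc 0 T).domRestrict y'), hy'.domRestrict.Icc_extend',
      fun u hu => IccExtend_of_mem hTle _ hu⟩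
  obtain ⟨M₁, hM₁⟩ := isCompact_Icc.exists_bound_of_continuousOn (hX.continuousOn (s := Icc 0 T))
  obtain ⟨M₂, hM₂⟩ := isCompact_Icc.exists_bound_of_continuousOn (hY.continuousOn (s := Icc 0 T))
  have hM : 0 ≤ max M₁ M₂ :=
    ((norm_nonneg _).trans (hM₁ 0 ⟨le_rfl, hTle⟩)).trans (le_max_left _ _)
  have hXM : ∀ u ∈ Icc 0 T, ∀ i, |X u i| ≤ max M₁ M₂ := fun u hu i =>
    (norm_le_pi_norm (X u) i).trans ((hM₁ u hu).trans (le_max_left _ _))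
  have hYM : ∀ u ∈ Icc 0 T, ∀ i, |Y u i| ≤ max M₁ M₂ := fun u hu i =>
    (norm_le_pi_norm (Y u) i).trans ((hM₂ u hu).trans (le_max_right _ _))
  have hsx : ∀ (w : List (Fin d)), ∀ s ∈ Icc 0 T, sigCoord x' w 0 s = sigCoord X w 0 s :=
    fun w s hs => (sigCoord_congr hXx w le_rfl hs.1 hs.2).symm
  have hsy : ∀ (w : List (Fin d)), ∀ t ∈ Icc 0 T, sigCoord y' w 0 t = sigCoord Y w 0 t :=
    fun w t ht => (sigCoord_congr hYy w le_rfl ht.1 ht.2).symm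
  have hsol : IsGoursatSolution T (fun u v => x' u ⬝ᵥ y' v)
      (fun s t => ∑' k : ℕ, ∑ w : Fin k → Fin d,
        sigCoord x' (List.ofFn w) 0 s * sigCoord y' (List.ofFn w) 0 t) :=
    (isGoursatSolution_sigKernel hX hY hXM hYM hM).congr
      (fun s hs t ht => by rw [hXx hs, hYy ht])
      (fun s hs t ht => by simp only [sigKernelLevel, hsx _ s hs, hsy _ t ht])
  refine ⟨fun s hs t ht => ?_, hsol, fun k₂ hk₂ s hs t ht => ?_⟩
  · simp only [hsx _ s hs, hsy _ t ht]
    exact Summable.of_nonneg_of_le (fun n => Finset.sum_nonneg fun w _ => abs_nonneg _)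
      (fun n => sum_abs_sigCoord_mul_le hX hY hXM hYM hM n hs ht)
      (Real.summable_pow_div_factorial _)
  · refine hk₂.unique ?_ hsol hs ht
    have hx₂ : ContinuousOn (fun p : ℝ × ℝ => x' p.1) (Icc 0 T ×ˢ Icc 0 T) :=
      hx'.comp continuousOn_fst fun p hp => hp.1
    have hy₂ : ContinuousOn (fun p : ℝ × ℝ => y' p.2) (Icc 0 T ×ˢ Icc 0 T) :=
      hy'.comp continuousOn_snd fun p hp => hp.2
    exact continuousOn_finsetSum Finset.univ fun i _ =>
      (continuousOn_pi.1 hx₂ i).mul (continuousOn_pi.1 hy₂ i)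
end

section
/- Let T > 0 and let q : [0,T]² → ℝ be measurable with |q(u,v)| ≤ a(u) b(v) for almost every (u,v), where a, b : [0,T] → [0,∞) are integrable. Then there exists a unique bounded continuous function k : [0,T]² → ℝ satisfying the Goursat–Volterra equation k(s,t) = 1 + ∫₀^s ∫₀^t q(u,v) k(u,v) dv du for all (s,t) ∈ [0,T]². -/
open MeasureTheory Set

/-- The integral of an integrable function over `(0,s] × (0,t]` is jointly continuous
in `(s,t)`. -/
theorem continuous_setIntegral_Ioc_prod {f : ℝ × ℝ → ℝ} (hf : Integrable f) :
    Continuous fun p : ℝ × ℝ => ∫ x in Ioc 0 p.1 ×ˢ Ioc 0 p.2, f x := by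
  have hmeas : ∀ p : ℝ × ℝ, MeasurableSet (Ioc 0 p.1 ×ˢ Ioc 0 p.2) := fun p =>
    measurableSet_Ioc.prod measurableSet_Ioc
  simp_rw [← integral_indicator (hmeas _)]
  refine continuous_iff_continuousAt.2 fun p₀ => ?_
  refine continuousAt_of_dominated (bound := fun x => ‖f x‖)
    (.of_forall fun p => hf.aestronglyMeasurable.indicator (hmeas p))
    (.of_forall fun p => .of_forall fun x => norm_indicator_le_norm_self f x) hf.norm ?_
  have hfst : ∀ᵐ x : ℝ × ℝ, x.1 ≠ p₀.1 :=
    Measure.quasiMeasurePreserving_fst.ae (Measure.ae_ne volume p₀.1)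
  have hsnd : ∀ᵐ x : ℝ × ℝ, x.2 ≠ p₀.2 :=
    Measure.quasiMeasurePreserving_snd.ae (Measure.ae_ne volume p₀.2)
  filter_upwards [hfst, hsnd] with x h₁ h₂
  have e₁ : ∀ᶠ p : ℝ × ℝ in nhds p₀, (x.1 ≤ p.1 ↔ x.1 ≤ p₀.1) := by
    rcases h₁.lt_or_gt with h | h
    · filter_upwards [continuous_fst.continuousAt.eventually (lt_mem_nhds h)] with p hp
      exact iff_of_true hp.le h.le
    · filter_upwards [continuous_fst.continuousAt.eventually (gt_mem_nhds h)] with p hp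
      exact iff_of_false hp.not_ge h.not_ge
  have e₂ : ∀ᶠ p : ℝ × ℝ in nhds p₀, (x.2 ≤ p.2 ↔ x.2 ≤ p₀.2) := by
    rcases h₂.lt_or_gt with h | h
    · filter_upwards [continuous_snd.continuousAt.eventually (lt_mem_nhds h)] with p hp
      exact iff_of_true hp.le h.le
    · filter_upwards [continuous_snd.continuousAt.eventually (gt_mem_nhds h)] with p hp
      exact iff_of_false hp.not_ge h.not_ge
  refine ContinuousAt.congr (f := fun _ => indicator (Ioc 0 p₀.1 ×ˢ Ioc 0 p₀.2) f x)
    continuousAt_const ?_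
  filter_upwards [e₁, e₂] with p hp₁ hp₂
  simp only [indicator, mem_prod, mem_Ioc, hp₁, hp₂]

theorem monotone_primitive_of_nonneg {a : ℝ → ℝ} (ha : Integrable a) (ha0 : ∀ u, 0 ≤ a u) :
    Monotone fun s : ℝ => ∫ u in (0 : ℝ)..s, a u := fun s t hst => by
  have h := intervalIntegral.integral_add_adjacent_intervals
    (ha.intervalIntegrable (a := 0) (b := s)) (ha.intervalIntegrable (a := s) (b := t))
  have := intervalIntegral.integral_nonneg (μ := volume) hst fun u _ => ha0 u
  dsimp only
  linarith

theorem setIntegral_mul_exp_primitive_le {a : ℝ → ℝ} (ha : Integrable a) (ha0 : ∀ u, 0 ≤ a u)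
    {c s : ℝ} (hc : 0 < c) (hs : 0 ≤ s) :
    ∫ u in Ioc 0 s, a u * Real.exp (c * ∫ x in (0 : ℝ)..u, a x) ≤
      Real.exp (c * ∫ x in (0 : ℝ)..s, a x) / c := by
  set F : ℝ → ℝ := fun s => Real.exp (c * ∫ x in (0 : ℝ)..s, a x) with hF
  have hmono : Monotone F := fun s t hst =>
    Real.exp_le_exp.2 (mul_le_mul_of_nonneg_left (monotone_primitive_of_nonneg ha ha0 hst) hc.le)
  have hderiv : ∀ᵐ u : ℝ, deriv F u = c * (a u * F u) := by
    filter_upwards [LocallyIntegrable.ae_hasDerivAt_integral ha.locallyIntegrable] with u hu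
    rw [(((hu 0).const_mul c).exp).deriv]
    ring
  have hle : ∫ u in (0 : ℝ)..s, deriv F u ≤ F s - F 0 := by
    have h := (hmono.monotoneOn (uIcc 0 s)).intervalIntegral_deriv_mem_uIcc
    rw [uIcc_of_le (sub_nonneg.2 (hmono hs))] at h
    exact h.2
  rw [intervalIntegral.integral_congr_ae (hderiv.mono fun u hu _ => hu),
    intervalIntegral.integral_const_mul, intervalIntegral.integral_of_le hs] at hle
  rw [le_div_iff₀' hc]
  linarith [Real.exp_pos (c * ∫ x in (0 : ℝ)..0, a x)]

theorem abs_setIntegral_Ioc_prod_le {f : ℝ × ℝ → ℝ} {g b : ℝ → ℝ} {s t D : ℝ}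
    (hg : IntegrableOn g (Ioc 0 s)) (hb : IntegrableOn b (Ioc 0 t))
    (hf : ∀ᵐ x : ℝ × ℝ, x ∈ Ioc 0 s ×ˢ Ioc 0 t → |f x| ≤ D * (g x.1 * b x.2)) :
    |∫ x in Ioc 0 s ×ˢ Ioc 0 t, f x| ≤ D * ((∫ u in Ioc 0 s, g u) * ∫ v in Ioc 0 t, b v) := by
  have hint : IntegrableOn (fun x : ℝ × ℝ => D * (g x.1 * b x.2)) (Ioc 0 s ×ˢ Ioc 0 t) := by
    rw [IntegrableOn, Measure.volume_eq_prod, ← Measure.prod_restrict]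
    exact (Integrable.mul_prod hg hb).const_mul D
  calc |∫ x in Ioc 0 s ×ˢ Ioc 0 t, f x|
      ≤ ∫ x in Ioc 0 s ×ˢ Ioc 0 t, D * (g x.1 * b x.2) :=
        norm_integral_le_of_norm_le (f := f) hint
          ((ae_restrict_iff' (measurableSet_Ioc.prod measurableSet_Ioc)).2 hf)
    _ = D * ((∫ u in Ioc 0 s, g u) * ∫ v in Ioc 0 t, b v) := by
        rw [integral_const_mul, Measure.volume_eq_prod, setIntegral_prod_mul]

/-- The extension of `k : C([0,T]², ℝ)` to the plane by projection onto the square. -/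
noncomputable def squareExtend {T : ℝ} (hT : 0 ≤ T) (k : C(Icc (0 : ℝ) T × Icc (0 : ℝ) T, ℝ))
    (x : ℝ × ℝ) : ℝ :=
  k (projIcc 0 T hT x.1, projIcc 0 T hT x.2)

theorem continuous_squareExtend {T : ℝ} (hT : 0 ≤ T)
    (k : C(Icc (0 : ℝ) T × Icc (0 : ℝ) T, ℝ)) : Continuous (squareExtend hT k) := by
  unfold squareExtend
  exact k.continuous.comp ((continuous_projIcc.comp continuous_fst).prodMk
    (continuous_projIcc.comp continuous_snd))

theorem integrable_mul_squareExtend {T : ℝ} (hT : 0 ≤ T) {q : ℝ × ℝ → ℝ} (hq : Integrable q)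
    (k : C(Icc (0 : ℝ) T × Icc (0 : ℝ) T, ℝ)) :
    Integrable fun x => q x * squareExtend hT k x :=
  hq.mul_bdd (c := ‖k‖) (continuous_squareExtend hT k).aestronglyMeasurable
    (.of_forall fun _ => k.norm_coe_le_norm _)

/-- The Goursat–Volterra integral operator on `C([0,T]², ℝ)`. -/
noncomputable def goursatOperator {T : ℝ} (hT : 0 ≤ T) {q : ℝ × ℝ → ℝ} (hq : Integrable q)
    (k : C(Icc (0 : ℝ) T × Icc (0 : ℝ) T, ℝ)) : C(Icc (0 : ℝ) T × Icc (0 : ℝ) T, ℝ) where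
  toFun p := ∫ x in Ioc 0 (p.1 : ℝ) ×ˢ Ioc 0 (p.2 : ℝ), q x * squareExtend hT k x
  continuous_toFun :=
    (continuous_setIntegral_Ioc_prod (integrable_mul_squareExtend hT hq k)).comp
      ((continuous_subtype_val.comp continuous_fst).prodMk
        (continuous_subtype_val.comp continuous_snd))

/-- The Goursat–Volterra equation has a unique continuous solution: after division by the weight
`exp (c ∫₀^s a)` with `c` large, the right-hand side is a contraction for the sup norm. -/
theorem existsUnique_eq_one_add_goursatOperator {T : ℝ} (hT : 0 ≤ T) {q : ℝ × ℝ → ℝ}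
    (hq : Integrable q) {a b : ℝ → ℝ} (ha : Integrable a) (hb : Integrable b)
    (ha0 : ∀ u, 0 ≤ a u) (hb0 : ∀ v, 0 ≤ b v)
    (hdom : ∀ᵐ x : ℝ × ℝ, |q x| ≤ a x.1 * b x.2) :
    ∃! k : C(Icc (0 : ℝ) T × Icc (0 : ℝ) T, ℝ), k = 1 + goursatOperator hT hq k := by
  set B : ℝ := ∫ v, b v with hB
  have hB0 : 0 ≤ B := integral_nonneg hb0
  set c : ℝ := 2 * B + 1 with hc
  have hc0 : 0 < c := by positivity
  set E : ℝ → ℝ := fun s => Real.exp (c * ∫ x in (0 : ℝ)..s, a x) with hE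
  have hEpos : ∀ s, 0 < E s := fun s => Real.exp_pos _
  have hEcont : Continuous E :=
    Real.continuous_exp.comp (continuous_const.mul
      (intervalIntegral.continuous_primitive (fun _ _ => ha.intervalIntegrable) 0))
  let e : C(Icc (0 : ℝ) T × Icc (0 : ℝ) T, ℝ) :=
    ⟨fun p => E p.1, hEcont.comp (continuous_subtype_val.comp continuous_fst)⟩
  let e' : C(Icc (0 : ℝ) T × Icc (0 : ℝ) T, ℝ) :=
    ⟨fun p => (E p.1)⁻¹, (hEcont.comp (continuous_subtype_val.comp continuous_fst)).inv₀
      fun p => (hEpos _).ne'⟩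
  have hee' : e * e' = 1 := by
    ext p
    exact mul_inv_cancel₀ (hEpos _).ne'
  let Φ : C(Icc (0 : ℝ) T × Icc (0 : ℝ) T, ℝ) → C(Icc (0 : ℝ) T × Icc (0 : ℝ) T, ℝ) :=
    fun h => e' * (1 + goursatOperator hT hq (e * h))
  have hΦ : ContractingWith (1 / 2) Φ := by
    refine ⟨by norm_num, LipschitzWith.of_dist_le_mul fun h₁ h₂ => ?_⟩
    rw [ContinuousMap.dist_le (by positivity)]
    rintro ⟨⟨s, hs⟩, ⟨t, ht⟩⟩
    have hsub : (∫ x in Ioc 0 s ×ˢ Ioc 0 t, q x * squareExtend hT (e * h₁) x) -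
        ∫ x in Ioc 0 s ×ˢ Ioc 0 t, q x * squareExtend hT (e * h₂) x =
        ∫ x in Ioc 0 s ×ˢ Ioc 0 t,
          (q x * squareExtend hT (e * h₁) x - q x * squareExtend hT (e * h₂) x) :=
      (integral_sub (integrable_mul_squareExtend hT hq _).integrableOn
        (integrable_mul_squareExtend hT hq _).integrableOn).symm
    have haE : IntegrableOn (fun u => a u * E u) (Ioc 0 s) :=
      (ha.integrableOn.mul_continuousOn hEcont.continuousOn isCompact_Icc).mono_set
        Ioc_subset_Icc_self
    have hbound : |∫ x in Ioc 0 s ×ˢ Ioc 0 t,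
          (q x * squareExtend hT (e * h₁) x - q x * squareExtend hT (e * h₂) x)| ≤
        dist h₁ h₂ * ((∫ u in Ioc 0 s, a u * E u) * ∫ v in Ioc 0 t, b v) := by
      refine abs_setIntegral_Ioc_prod_le haE hb.integrableOn ?_
      filter_upwards [hdom] with x hx hmem
      have hx₁ : x.1 ∈ Icc 0 T := ⟨hmem.1.1.le, hmem.1.2.trans hs.2⟩
      have key : q x * squareExtend hT (e * h₁) x - q x * squareExtend hT (e * h₂) x =
          q x * (E x.1 * (squareExtend hT h₁ x - squareExtend hT h₂ x)) := by
        simp only [squareExtend, ContinuousMap.mul_apply, e, ContinuousMap.coe_mk,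
          projIcc_of_mem hT hx₁]
        ring
      have hd : |squareExtend hT h₁ x - squareExtend hT h₂ x| ≤ dist h₁ h₂ :=
        ContinuousMap.dist_apply_le_dist (f := h₁) (g := h₂) _
      rw [key, abs_mul, abs_mul, abs_of_pos (hEpos _)]
      calc |q x| * (E x.1 * |squareExtend hT h₁ x - squareExtend hT h₂ x|)
          ≤ (a x.1 * b x.2) * (E x.1 * dist h₁ h₂) := by
            have := (hEpos x.1).le
            have := mul_nonneg (ha0 x.1) (hb0 x.2)
            gcongr
        _ = dist h₁ h₂ * (a x.1 * E x.1 * b x.2) := by ring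
    have hbB : ∫ v in Ioc 0 t, b v ≤ B :=
      setIntegral_le_integral hb (.of_forall hb0)
    have hEs : 0 < E s := hEpos s
    calc dist (Φ h₁ (⟨s, hs⟩, ⟨t, ht⟩)) (Φ h₂ (⟨s, hs⟩, ⟨t, ht⟩))
        = (E s)⁻¹ * |∫ x in Ioc 0 s ×ˢ Ioc 0 t,
          (q x * squareExtend hT (e * h₁) x - q x * squareExtend hT (e * h₂) x)| := by
          rw [← hsub, Real.dist_eq, ← abs_of_pos (inv_pos.2 hEs), ← abs_mul]
          congr 1
          simp only [Φ, e', goursatOperator, ContinuousMap.mul_apply, ContinuousMap.add_apply,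
            ContinuousMap.one_apply, ContinuousMap.coe_mk]
          ring
      _ ≤ (E s)⁻¹ * (dist h₁ h₂ * (E s / c * B)) := by
          have := setIntegral_mul_exp_primitive_le ha ha0 hc0 hs.1
          have h0 : 0 ≤ ∫ v in Ioc 0 t, b v := integral_nonneg hb0
          refine mul_le_mul_of_nonneg_left (hbound.trans ?_) (inv_pos.2 hEs).le
          gcongr
      _ = B / c * dist h₁ h₂ := by field_simp
      _ ≤ (1 / 2 : NNReal) * dist h₁ h₂ := by
          refine mul_le_mul_of_nonneg_right ?_ dist_nonneg
          rw [div_le_iff₀ hc0]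
          push_cast
          linarith
  have hfix : ∀ h, Φ h = h ↔ e * h = 1 + goursatOperator hT hq (e * h) := fun h => by
    constructor
    · intro hh
      conv_lhs => rw [← hh]
      simp only [Φ]
      rw [← mul_assoc, hee', one_mul]
    · intro hh
      simp only [Φ]
      rw [← hh, ← mul_assoc, mul_comm e', hee', one_mul]
  refine ⟨e * hΦ.fixedPoint Φ, (hfix _).1 hΦ.fixedPoint_isFixedPt, fun k hk => ?_⟩
  have hk' : e * (e' * k) = k := by rw [← mul_assoc, hee', one_mul]
  rw [← hΦ.fixedPoint_unique ((hfix (e' * k)).2 (by rwa [hk'])), hk']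

/-- If `q : [0,T]² → ℝ` is measurable and dominated a.e. by `a(u)b(v)` with
`a, b : [0,T] → [0,∞)` integrable, then there exists a unique bounded continuous solution of
the Goursat–Volterra equation with kernel `q`. -/
theorem stmt9 {T : ℝ} (hT : 0 < T) (q : ℝ → ℝ → ℝ) (a b : ℝ → ℝ)
    (hq : Measurable (Function.uncurry q))
    (ha0 : ∀ u ∈ Icc (0 : ℝ) T, 0 ≤ a u) (hb0 : ∀ v ∈ Icc (0 : ℝ) T, 0 ≤ b v)
    (ha : IntegrableOn a (Icc 0 T)) (hb : IntegrableOn b (Icc 0 T))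
    (hdom : ∀ᵐ p ∂(volume.restrict (Icc (0 : ℝ) T ×ˢ Icc (0 : ℝ) T)),
      |q p.1 p.2| ≤ a p.1 * b p.2) :
    ∃ k : ℝ → ℝ → ℝ, IsGoursatSolution T q k ∧
      ∀ k₂ : ℝ → ℝ → ℝ, IsGoursatSolution T q k₂ →
        ∀ s ∈ Icc (0 : ℝ) T, ∀ t ∈ Icc (0 : ℝ) T, k₂ s t = k s t := by
  have hSm : MeasurableSet (Icc (0 : ℝ) T ×ˢ Icc (0 : ℝ) T) :=
    measurableSet_Icc.prod measurableSet_Icc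
  set q' : ℝ × ℝ → ℝ := indicator (Icc (0 : ℝ) T ×ˢ Icc (0 : ℝ) T) (Function.uncurry q) with hq'
  have ha' : Integrable (indicator (Icc 0 T) a) := ha.integrable_indicator measurableSet_Icc
  have hb' : Integrable (indicator (Icc 0 T) b) := hb.integrable_indicator measurableSet_Icc
  have hdom' : ∀ᵐ x : ℝ × ℝ, |q' x| ≤ indicator (Icc 0 T) a x.1 * indicator (Icc 0 T) b x.2 := by
    filter_upwards [(ae_restrict_iff' hSm).1 hdom] with x hx
    by_cases hmem : x ∈ Icc (0 : ℝ) T ×ˢ Icc (0 : ℝ) T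
    · rw [hq', indicator_of_mem hmem, indicator_of_mem hmem.1, indicator_of_mem hmem.2]
      exact hx hmem
    · rw [hq', indicator_of_notMem hmem, abs_zero]
      exact mul_nonneg (indicator_nonneg ha0 _) (indicator_nonneg hb0 _)
  have hqint : Integrable q' :=
    (ha'.mul_prod hb').mono' (hq.indicator hSm).aestronglyMeasurable hdom'
  have hiter : ∀ (k : ℝ → ℝ → ℝ) (κ : C(Icc (0 : ℝ) T × Icc (0 : ℝ) T, ℝ)),
      (∀ s t, (hs : s ∈ Icc 0 T) → (ht : t ∈ Icc 0 T) → k s t = κ (⟨s, hs⟩, ⟨t, ht⟩)) →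
      ∀ s t, (hs : s ∈ Icc 0 T) → (ht : t ∈ Icc 0 T) →
        ∫ u in (0 : ℝ)..s, ∫ v in (0 : ℝ)..t, q u v * k u v =
          goursatOperator hT.le hqint κ (⟨s, hs⟩, ⟨t, ht⟩) := by
    intro k κ hk s t hs ht
    simp only [goursatOperator, ContinuousMap.coe_mk]
    rw [Measure.volume_eq_prod, setIntegral_prod _
      (integrable_mul_squareExtend hT.le hqint κ).integrableOn,
      intervalIntegral.integral_of_le hs.1]
    refine setIntegral_congr_fun measurableSet_Ioc fun u hu => ?_
    have hu' : u ∈ Icc 0 T := ⟨hu.1.le, hu.2.trans hs.2⟩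
    rw [intervalIntegral.integral_of_le ht.1]
    refine setIntegral_congr_fun measurableSet_Ioc fun v hv => ?_
    have hv' : v ∈ Icc 0 T := ⟨hv.1.le, hv.2.trans ht.2⟩
    simp only [hq', squareExtend, projIcc_of_mem hT.le hu', projIcc_of_mem hT.le hv',
      indicator_of_mem (mk_mem_prod hu' hv'), Function.uncurry_apply_pair, hk u v hu' hv']
  obtain ⟨κ, hκ, huniq⟩ := existsUnique_eq_one_add_goursatOperator hT.le hqint ha' hb'
    (indicator_nonneg ha0) (indicator_nonneg hb0) hdom'
  have hext : ∀ s t, (hs : s ∈ Icc 0 T) → (ht : t ∈ Icc 0 T) →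
      squareExtend hT.le κ (s, t) = κ (⟨s, hs⟩, ⟨t, ht⟩) := fun s t hs ht => by
    simp only [squareExtend, projIcc_of_mem hT.le hs, projIcc_of_mem hT.le ht]
  refine ⟨fun s t => squareExtend hT.le κ (s, t),
    ⟨(continuous_squareExtend hT.le κ).continuousOn,
      ⟨‖κ‖, fun s _ t _ => κ.norm_coe_le_norm _⟩, fun s hs t ht => ?_⟩,
    fun k₂ ⟨hcont, _, heq⟩ s hs t ht => ?_⟩
  · rw [hiter _ κ hext s t hs ht]
    exact (hext s t hs ht).trans (DFunLike.congr_fun hκ _)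
  · let κ₂ : C(Icc (0 : ℝ) T × Icc (0 : ℝ) T, ℝ) :=
      ⟨fun p => k₂ p.1 p.2, hcont.comp_continuous
        ((continuous_subtype_val.comp continuous_fst).prodMk
          (continuous_subtype_val.comp continuous_snd)) fun p => ⟨p.1.2, p.2.2⟩⟩
    have hκ₂ : κ₂ = κ := huniq κ₂ <| by
      ext ⟨⟨s, hs⟩, ⟨t, ht⟩⟩
      exact (heq s hs t ht).trans
        (congrArg (1 + ·) (hiter k₂ κ₂ (fun _ _ _ _ => rfl) s t hs ht))
    exact (DFunLike.congr_fun hκ₂ (⟨s, hs⟩, ⟨t, ht⟩)).trans (hext s t hs ht).symm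
end

section
/- Let T > 0 and let q : [0,T]² → ℝ be measurable with |q(u,v)| ≤ a(u) b(v) for almost every (u,v), where a, b : [0,T] → [0,∞) are integrable. If k : [0,T]² → ℝ is a bounded continuous solution of the Goursat–Volterra equation with kernel q, then for all (s,t) ∈ [0,T]², |k(s,t)| ≤ exp( (∫₀^s a(u) du) · (∫₀^t b(v) dv) ). -/
open MeasureTheory Set

/-- Postcomposing an absolutely continuous function with a function which is Lipschitz on its
range preserves absolute continuity. -/
theorem AbsolutelyContinuousOnInterval.lipschitzOnWith_comp {f H : ℝ → ℝ} {c d : ℝ} {K : NNReal}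
    (hf : AbsolutelyContinuousOnInterval f c d) (hH : LipschitzOnWith K H (f '' uIcc c d)) :
    AbsolutelyContinuousOnInterval (fun x => H (f x)) c d := by
  unfold AbsolutelyContinuousOnInterval at hf ⊢
  refine squeeze_zero' (Filter.Eventually.of_forall fun _ =>
    Finset.sum_nonneg fun _ _ => dist_nonneg) ?_ (by simpa using hf.const_mul (K : ℝ))
  rw [Filter.eventually_inf_principal]
  filter_upwards with E hE
  rw [Finset.mul_sum]
  exact Finset.sum_le_sum fun i hi => hH.dist_le_mul _ (mem_image_of_mem f (hE.1 i hi).1) _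
    (mem_image_of_mem f (hE.1 i hi).2)

/-- Change of variables along the primitive of an integrable function. -/
theorem IntervalIntegrable.integral_mul_deriv_comp_primitive {f H : ℝ → ℝ} {c d : ℝ}
    (hf : IntervalIntegrable f volume c d) (hH : ContDiff ℝ 1 H) :
    ∫ x in c..d, f x * deriv H (∫ y in c..x, f y) = H (∫ y in c..d, f y) - H 0 := by
  have hac : AbsolutelyContinuousOnInterval (fun x => ∫ y in c..x, f y) c d :=
    hf.absolutelyContinuousOnInterval_intervalIntegral left_mem_uIcc
  obtain ⟨R, hR⟩ := hac.exists_bound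
  obtain ⟨K, hK⟩ := (hH.contDiffOn (s := Icc (-R) R)).exists_lipschitzOnWith (by decide)
    (convex_Icc _ _) isCompact_Icc
  have hcomp := hac.lipschitzOnWith_comp (hK.mono (by
    rintro _ ⟨x, hx, rfl⟩
    exact abs_le.mp (hR x hx)))
  have hint := hcomp.integral_deriv_eq_sub
  rw [intervalIntegral.integral_same] at hint
  rw [← hint]
  apply intervalIntegral.integral_congr_ae
  filter_upwards [hf.ae_hasDerivAt_integral] with x hx hxcd
  have hx' := hx (uIoc_subset_uIcc hxcd) c left_mem_uIcc
  have hd := ((hH.differentiable (by decide)).differentiableAt.hasDerivAt).comp x hx'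
  rw [mul_comm]
  exact hd.deriv.symm

/-- One Picard iteration: a majorant of `|k|` of the form `g ((∫₀^s a) (∫₀^t b))` can be improved
by inserting it into the equation. -/
theorem IsGoursatSolution.abs_le_one_add_integral {T : ℝ} {q k : ℝ → ℝ → ℝ} {a b g : ℝ → ℝ}
    (ha0 : ∀ u ∈ Icc (0 : ℝ) T, 0 ≤ a u) (hb0 : ∀ v ∈ Icc (0 : ℝ) T, 0 ≤ b v)
    (ha : IntegrableOn a (Icc 0 T)) (hb : IntegrableOn b (Icc 0 T))
    (hdom : ∀ᵐ p ∂(volume.restrict (Icc (0 : ℝ) T ×ˢ Icc (0 : ℝ) T)),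
      |q p.1 p.2| ≤ a p.1 * b p.2)
    (hk : IsGoursatSolution T q k) (hg : Continuous g) (hgmono : MonotoneOn g (Ici 0))
    (hkg : ∀ s ∈ Icc (0 : ℝ) T, ∀ t ∈ Icc (0 : ℝ) T,
      |k s t| ≤ g ((∫ u in (0 : ℝ)..s, a u) * ∫ v in (0 : ℝ)..t, b v))
    {s t : ℝ} (hs : s ∈ Icc 0 T) (ht : t ∈ Icc 0 T) :
    |k s t| ≤ 1 + ∫ u in (0 : ℝ)..s, a u * ((∫ v in (0 : ℝ)..t, b v) *
      g ((∫ w in (0 : ℝ)..u, a w) * ∫ v in (0 : ℝ)..t, b v)) := by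
  have hai : IntervalIntegrable a volume 0 s :=
    (intervalIntegrable_iff_integrableOn_Icc_of_le hs.1).mpr
      (ha.mono_set (Icc_subset_Icc_right hs.2))
  have hbi : IntervalIntegrable b volume 0 t :=
    (intervalIntegrable_iff_integrableOn_Icc_of_le ht.1).mpr
      (hb.mono_set (Icc_subset_Icc_right ht.2))
  have hdom' : ∀ᵐ u, u ∈ Icc 0 T → ∀ᵐ v, v ∈ Icc 0 T → |q u v| ≤ a u * b v := by
    rw [Measure.volume_eq_prod, ← Measure.prod_restrict] at hdom
    have h := Measure.ae_ae_of_ae_prod hdom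
    rw [ae_restrict_iff' measurableSet_Icc] at h
    filter_upwards [h] with u hu hu'
    exact (ae_restrict_iff' measurableSet_Icc).mp (hu hu')
  rw [hk.2.2 s hs t ht]
  refine (abs_add_le _ _).trans ?_
  rw [abs_one]
  gcongr
  rw [← Real.norm_eq_abs]
  refine intervalIntegral.norm_integral_le_of_norm_le hs.1 ?_ ?_
  · filter_upwards [hdom'] with u hu hus
    have huT : u ∈ Icc 0 T := ⟨hus.1.le, hus.2.trans hs.2⟩
    set G := g ((∫ w in (0 : ℝ)..u, a w) * ∫ v in (0 : ℝ)..t, b v)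
    have key : ‖∫ v in (0 : ℝ)..t, q u v * k u v‖ ≤ ∫ v in (0 : ℝ)..t, a u * G * b v := by
      refine intervalIntegral.norm_integral_le_of_norm_le ht.1 ?_ (hbi.const_mul _)
      filter_upwards [hu huT] with v hv hvt
      have hvT : v ∈ Icc 0 T := ⟨hvt.1.le, hvt.2.trans ht.2⟩
      have hA : 0 ≤ ∫ w in (0 : ℝ)..u, a w := intervalIntegral.integral_nonneg huT.1
        fun w hw => ha0 w ⟨hw.1, hw.2.trans huT.2⟩
      have hB : 0 ≤ ∫ w in (0 : ℝ)..v, b w := intervalIntegral.integral_nonneg hvT.1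
        fun w hw => hb0 w ⟨hw.1, hw.2.trans hvT.2⟩
      have hBle : ∫ w in (0 : ℝ)..v, b w ≤ ∫ w in (0 : ℝ)..t, b w := by
        refine intervalIntegral.integral_mono_interval le_rfl hvT.1 hvt.2 ?_ hbi
        rw [Filter.EventuallyLE, ae_restrict_iff' measurableSet_Ioc]
        exact Filter.Eventually.of_forall fun w hw => hb0 w ⟨hw.1.le, hw.2.trans ht.2⟩
      have hkG : |k u v| ≤ G := (hkg u huT v hvT).trans <|
        hgmono (mul_nonneg hA hB) (mul_nonneg hA (hB.trans hBle))
          (mul_le_mul_of_nonneg_left hBle hA)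
      rw [Real.norm_eq_abs, abs_mul]
      calc |q u v| * |k u v| ≤ (a u * b v) * G :=
            mul_le_mul (hv hvT) hkG (abs_nonneg _) (mul_nonneg (ha0 u huT) (hb0 v hvT))
        _ = a u * G * b v := by ring
    rw [intervalIntegral.integral_const_mul] at key
    exact key.trans_eq (by ring)
  · refine hai.mul_continuousOn ?_
    have hAc := (hai.absolutelyContinuousOnInterval_intervalIntegral
      (c := 0) left_mem_uIcc).continuousOn
    exact continuousOn_const.mul (hg.comp_continuousOn (hAc.mul continuousOn_const))

/-- The error term of the Picard iteration started from a constant bound on `k`. -/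
theorem IsGoursatSolution.abs_le_exp_add {T C : ℝ} {q k : ℝ → ℝ → ℝ} {a b : ℝ → ℝ}
    (ha0 : ∀ u ∈ Icc (0 : ℝ) T, 0 ≤ a u) (hb0 : ∀ v ∈ Icc (0 : ℝ) T, 0 ≤ b v)
    (ha : IntegrableOn a (Icc 0 T)) (hb : IntegrableOn b (Icc 0 T))
    (hdom : ∀ᵐ p ∂(volume.restrict (Icc (0 : ℝ) T ×ˢ Icc (0 : ℝ) T)),
      |q p.1 p.2| ≤ a p.1 * b p.2)
    (hk : IsGoursatSolution T q k) (hC0 : 0 ≤ C)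
    (hC : ∀ s ∈ Icc (0 : ℝ) T, ∀ t ∈ Icc (0 : ℝ) T, |k s t| ≤ C) (n : ℕ) :
    ∀ s ∈ Icc (0 : ℝ) T, ∀ t ∈ Icc (0 : ℝ) T,
      |k s t| ≤ Real.exp ((∫ u in (0 : ℝ)..s, a u) * ∫ v in (0 : ℝ)..t, b v) +
        C * (((∫ u in (0 : ℝ)..s, a u) * ∫ v in (0 : ℝ)..t, b v) ^ n / n.factorial) := by
  induction n with
  | zero =>
    intro s hs t ht
    simpa using (hC s hs t ht).trans (le_add_of_nonneg_left (Real.exp_pos _).le)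
  | succ n ih =>
    intro s hs t ht
    have hstep := hk.abs_le_one_add_integral ha0 hb0 ha hb hdom
      (g := fun x => Real.exp x + C * (x ^ n / n.factorial)) (by fun_prop)
      (fun x hx y _ hxy => by
        have hx' : 0 ≤ x := hx
        dsimp only
        gcongr) ih hs ht
    have hai : IntervalIntegrable a volume 0 s :=
      (intervalIntegrable_iff_integrableOn_Icc_of_le hs.1).mpr
      (ha.mono_set (Icc_subset_Icc_right hs.2))
    set β := ∫ v in (0 : ℝ)..t, b v
    set H : ℝ → ℝ := fun x =>
      Real.exp (x * β) + C * ((x * β) ^ (n + 1) / (n + 1).factorial) with hH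
    have hHd : ∀ x, deriv H x = β * (Real.exp (x * β) + C * ((x * β) ^ n / n.factorial)) := by
      intro x
      have h1 : HasDerivAt (fun x : ℝ => x * β) β x := by
        simpa using (hasDerivAt_id x).mul_const β
      have h2 := h1.exp.add (((h1.pow (n + 1)).div_const ((n + 1).factorial : ℝ)).const_mul C)
      refine h2.deriv.trans ?_
      have hn : (n.factorial : ℝ) ≠ 0 := by positivity
      have hn' : (n : ℝ) + 1 ≠ 0 := by positivity
      rw [Nat.factorial_succ]
      push_cast
      field_simp
    have hHint := hai.integral_mul_deriv_comp_primitive (H := H) (by fun_prop)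
    simp only [hHd] at hHint
    rw [hHint] at hstep
    have hH0 : H 0 = 1 := by simp [hH]
    rw [hH0] at hstep
    exact hstep.trans_eq (by simp only [hH]; ring)

/-- **Grönwall bound.** If `q` is measurable with `|q(u,v)| ≤ a(u)b(v)` a.e.,
`a, b ≥ 0` integrable on `[0,T]`, and `k` is a bounded continuous solution of the
Goursat–Volterra equation with kernel `q`, then
`|k(s,t)| ≤ exp((∫₀^s a)(∫₀^t b))` on `[0,T]²`. -/
theorem stmt10 {T : ℝ} (hT : 0 < T) (q : ℝ → ℝ → ℝ) (a b : ℝ → ℝ)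
    (hq : Measurable (Function.uncurry q))
    (ha0 : ∀ u ∈ Icc (0 : ℝ) T, 0 ≤ a u) (hb0 : ∀ v ∈ Icc (0 : ℝ) T, 0 ≤ b v)
    (ha : IntegrableOn a (Icc 0 T)) (hb : IntegrableOn b (Icc 0 T))
    (hdom : ∀ᵐ p ∂(volume.restrict (Icc (0 : ℝ) T ×ˢ Icc (0 : ℝ) T)),
      |q p.1 p.2| ≤ a p.1 * b p.2)
    (k : ℝ → ℝ → ℝ) (hk : IsGoursatSolution T q k) :
    ∀ s ∈ Icc (0 : ℝ) T, ∀ t ∈ Icc (0 : ℝ) T,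
      |k s t| ≤ Real.exp ((∫ u in (0 : ℝ)..s, a u) * (∫ v in (0 : ℝ)..t, b v)) := by
  intro s hs t ht
  obtain ⟨C, hC⟩ := hk.2.1
  have hC0 : 0 ≤ C := (abs_nonneg _).trans (hC s hs t ht)
  have hlim := ((FloorSemiring.tendsto_pow_div_factorial_atTop
    ((∫ u in (0 : ℝ)..s, a u) * ∫ v in (0 : ℝ)..t, b v)).const_mul C).const_add
      (Real.exp ((∫ u in (0 : ℝ)..s, a u) * ∫ v in (0 : ℝ)..t, b v))
  rw [mul_zero, add_zero] at hlim
  exact ge_of_tendsto' hlim fun n =>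
    hk.abs_le_exp_add ha0 hb0 ha hb hdom hC0 hC n s hs t ht
end

section
/- Let T > 0, let a, b : [0,T] → [0,∞) be integrable, and let q_n, q : [0,T]² → ℝ be measurable kernels satisfying |q_n(u,v)| ≤ a(u) b(v) and |q(u,v)| ≤ a(u) b(v) for almost every (u,v) and all n. Suppose ∫₀^T ∫₀^T |q_n(u,v) − q(u,v)| du dv → 0 as n → ∞. Let k_n and k be the unique bounded continuous solutions of the Goursat–Volterra equations with kernels q_n and q respectively. Then k_n → k uniformly on [0,T]². -/
open MeasureTheory Set Filter

open scoped NNReal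

/-- A Lipschitz function composed with an absolutely continuous one is absolutely continuous. -/
theorem LipschitzOnWith.comp_absolutelyContinuousOnInterval {g f : ℝ → ℝ} {K : ℝ≥0} {S : Set ℝ}
    {a b : ℝ} (hg : LipschitzOnWith K g S) (hf : AbsolutelyContinuousOnInterval f a b)
    (hfS : MapsTo f (uIcc a b) S) :
    AbsolutelyContinuousOnInterval (fun x => g (f x)) a b := by
  rw [absolutelyContinuousOnInterval_iff] at hf ⊢
  intro ε hε
  obtain ⟨δ, hδ, h⟩ := hf (ε / (K + 1)) (by positivity)
  refine ⟨δ, hδ, fun E hE hlen => ?_⟩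
  calc
    _ ≤ ∑ i ∈ Finset.range E.1, (K : ℝ) * dist (f (E.2 i).1) (f (E.2 i).2) :=
      Finset.sum_le_sum fun i hi =>
        hg.dist_le_mul _ (hfS (hE.1 i hi).1) _ (hfS (hE.1 i hi).2)
    _ = K * ∑ i ∈ Finset.range E.1, dist (f (E.2 i).1) (f (E.2 i).2) :=
      (Finset.mul_sum _ _ _).symm
    _ ≤ K * (ε / (K + 1)) := by gcongr; exact (h E hE hlen).le
    _ < (K + 1) * (ε / (K + 1)) := by gcongr; linarith
    _ = ε := by field

/-- The fundamental theorem of calculus for the exponential of a primitive of an integrable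
function. -/
theorem integral_mul_exp_primitive {a : ℝ → ℝ} {s : ℝ} (ha : IntervalIntegrable a volume 0 s)
    (l : ℝ) :
    l * ∫ u in (0 : ℝ)..s, a u * Real.exp (l * ∫ x in (0 : ℝ)..u, a x) =
      Real.exp (l * ∫ x in (0 : ℝ)..s, a x) - 1 := by
  have hA : AbsolutelyContinuousOnInterval (fun u => l * ∫ x in (0 : ℝ)..u, a x) 0 s :=
    (ha.absolutelyContinuousOnInterval_intervalIntegral left_mem_uIcc).const_mul l
  obtain ⟨C, hC⟩ := hA.exists_bound
  obtain ⟨K, hK⟩ := (Real.contDiff_exp (n := 1)).contDiffOn.exists_lipschitzOnWith (by decide)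
    (convex_Icc (-C) C) isCompact_Icc
  have hexp := hK.comp_absolutelyContinuousOnInterval hA fun u hu => abs_le.1 (hC u hu)
  have hint := hexp.integral_deriv_eq_sub
  simp only [intervalIntegral.integral_same, mul_zero, Real.exp_zero] at hint
  rw [← hint, ← intervalIntegral.integral_const_mul]
  apply intervalIntegral.integral_congr_ae
  filter_upwards [ha.ae_hasDerivAt_integral] with u hu hmem
  rw [((hu (uIoc_subset_uIcc hmem) 0 left_mem_uIcc).const_mul l).exp.deriv]
  ring

/-- The product weight `a ⊗ b` of integrable functions is integrable on the square `[0,T]²`. -/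
theorem integrableOn_mul_prod_Icc {T : ℝ} {a b : ℝ → ℝ}
    (ha : IntegrableOn a (Icc 0 T)) (hb : IntegrableOn b (Icc 0 T)) :
    IntegrableOn (fun p : ℝ × ℝ => a p.1 * b p.2) (Icc 0 T ×ˢ Icc 0 T) := by
  rw [IntegrableOn, Measure.volume_eq_prod, ← Measure.prod_restrict]
  exact ha.mul_prod hb

/-- A Gronwall inequality on the square `[0,T]²` with a product weight. -/
theorem abs_le_of_abs_le_add_setIntegral_prod {T : ℝ} {a b : ℝ → ℝ} {d : ℝ × ℝ → ℝ} {δ : ℝ}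
    (hT : 0 ≤ T) (ha0 : ∀ u ∈ Icc (0 : ℝ) T, 0 ≤ a u) (hb0 : ∀ v ∈ Icc (0 : ℝ) T, 0 ≤ b v)
    (ha : IntegrableOn a (Icc 0 T)) (hb : IntegrableOn b (Icc 0 T))
    (hd : ContinuousOn d (Icc 0 T ×ˢ Icc 0 T))
    (h : ∀ s ∈ Icc (0 : ℝ) T, ∀ t ∈ Icc (0 : ℝ) T,
      |d (s, t)| ≤ δ + ∫ p in Ioc 0 s ×ˢ Ioc 0 t, a p.1 * b p.2 * |d p|) :
    ∀ p ∈ Icc (0 : ℝ) T ×ˢ Icc (0 : ℝ) T,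
      |d p| ≤ 2 * δ * Real.exp ((2 * (∫ v in (0 : ℝ)..T, b v) + 1) * ∫ u in (0 : ℝ)..T, a u) := by
  have haI : IntervalIntegrable a volume 0 T :=
    (intervalIntegrable_iff_integrableOn_Icc_of_le hT).2 ha
  have hbI : IntervalIntegrable b volume 0 T :=
    (intervalIntegrable_iff_integrableOn_Icc_of_le hT).2 hb
  set B := ∫ v in (0 : ℝ)..T, b v with hB
  set l := 2 * B + 1 with hl
  set A : ℝ → ℝ := fun s => ∫ u in (0 : ℝ)..s, a u with hA
  have hB0 : 0 ≤ B := intervalIntegral.integral_nonneg hT hb0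
  have hAc : ContinuousOn A (Icc 0 T) := by
    have := (haI.absolutelyContinuousOnInterval_intervalIntegral left_mem_uIcc).continuousOn
    rwa [uIcc_of_le hT] at this
  have hA0 : ∀ s ∈ Icc 0 T, 0 ≤ A s := fun s hs =>
    intervalIntegral.integral_nonneg hs.1 fun u hu => ha0 u ⟨hu.1, hu.2.trans hs.2⟩
  have hAT : ∀ s ∈ Icc 0 T, A s ≤ A T := fun s hs =>
    intervalIntegral.integral_mono_interval le_rfl hs.1 hs.2
      ((ae_restrict_iff' measurableSet_Ioc).2 <| .of_forall fun u hu => ha0 u ⟨hu.1.le, hu.2⟩) haI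
  have hA1 : ContinuousOn (fun p : ℝ × ℝ => l * A p.1) (Icc 0 T ×ˢ Icc 0 T) :=
    (hAc.comp continuousOn_fst fun p hp => hp.1).const_mul l
  have hw : ContinuousOn (fun p : ℝ × ℝ => |d p| * Real.exp (-(l * A p.1)))
      (Icc 0 T ×ˢ Icc 0 T) := hd.abs.mul hA1.neg.rexp
  obtain ⟨m, hm, hmax⟩ := (isCompact_Icc.prod isCompact_Icc).exists_isMaxOn
    (⟨(0, 0), ⟨le_rfl, hT⟩, ⟨le_rfl, hT⟩⟩ : (Icc (0 : ℝ) T ×ˢ Icc (0 : ℝ) T).Nonempty) hw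
  set M := |d m| * Real.exp (-(l * A m.1)) with hM
  have hM0 : 0 ≤ M := by positivity
  have hdM : ∀ p ∈ Icc (0 : ℝ) T ×ˢ Icc (0 : ℝ) T, |d p| ≤ M * Real.exp (l * A p.1) := by
    intro p hp
    have := hmax hp
    simp only [mem_ofPred_eq] at this
    rwa [Real.exp_neg, ← div_eq_mul_inv, div_le_iff₀ (Real.exp_pos _)] at this
  obtain ⟨s, t⟩ := m
  obtain ⟨hs, ht⟩ := hm
  simp only at hs ht
  have hδ : M * Real.exp (l * A s) ≤ δ + M / 2 * Real.exp (l * A s) := by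
    have hsub : Ioc 0 s ×ˢ Ioc 0 t ⊆ Icc (0 : ℝ) T ×ˢ Icc (0 : ℝ) T :=
      prod_mono (fun u hu => ⟨hu.1.le, hu.2.trans hs.2⟩) fun u hu => ⟨hu.1.le, hu.2.trans ht.2⟩
    have hab := integrableOn_mul_prod_Icc ha hb
    have hK : IsCompact (Icc (0 : ℝ) T ×ˢ Icc (0 : ℝ) T) := isCompact_Icc.prod isCompact_Icc
    have hexp : ContinuousOn (fun p : ℝ × ℝ => M * Real.exp (l * A p.1))
        (Icc 0 T ×ˢ Icc 0 T) := hA1.rexp.const_mul M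
    have hle : ∫ p in Ioc 0 s ×ˢ Ioc 0 t, a p.1 * b p.2 * |d p| ≤
        ∫ p in Ioc 0 s ×ˢ Ioc 0 t, a p.1 * b p.2 * (M * Real.exp (l * A p.1)) := by
      refine setIntegral_mono_on ((hab.mul_continuousOn hd.abs hK).mono_set hsub)
        ((hab.mul_continuousOn hexp hK).mono_set hsub)
        (measurableSet_Ioc.prod measurableSet_Ioc) fun p hp => ?_
      have hp' := hsub hp
      exact mul_le_mul_of_nonneg_left (hdM p hp') (mul_nonneg (ha0 _ hp'.1) (hb0 _ hp'.2))
    have heq : ∫ p in Ioc 0 s ×ˢ Ioc 0 t, a p.1 * b p.2 * (M * Real.exp (l * A p.1)) =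
        M * (∫ u in (0 : ℝ)..s, a u * Real.exp (l * A u)) * ∫ v in (0 : ℝ)..t, b v := by
      rw [intervalIntegral.integral_of_le hs.1, intervalIntegral.integral_of_le ht.1, mul_assoc,
        ← setIntegral_prod_mul, ← integral_const_mul, Measure.volume_eq_prod]
      congr 1 with p
      ring
    have hBt : ∫ v in (0 : ℝ)..t, b v ≤ B :=
      intervalIntegral.integral_mono_interval le_rfl ht.1 ht.2
        ((ae_restrict_iff' measurableSet_Ioc).2 <| .of_forall fun u hu => hb0 u ⟨hu.1.le, hu.2⟩)
        hbI
    have hftc := integral_mul_exp_primitive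
      (s := s) (haI.mono_set (uIcc_subset_uIcc_left (by rwa [uIcc_of_le hT]))) l
    have hI0 : 0 ≤ ∫ u in (0 : ℝ)..s, a u * Real.exp (l * A u) :=
      intervalIntegral.integral_nonneg hs.1 fun u hu =>
        mul_nonneg (ha0 u ⟨hu.1, hu.2.trans hs.2⟩) (Real.exp_pos _).le
    have hds : |d (s, t)| = M * Real.exp (l * A s) := by
      rw [hM, mul_assoc, ← Real.exp_add]
      simp
    have hhalf : (∫ u in (0 : ℝ)..s, a u * Real.exp (l * A u)) * B ≤ Real.exp (l * A s) / 2 := by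
      simp only [hA] at hI0 ⊢
      rw [hl] at hftc hI0 ⊢
      nlinarith
    have hs' := h s hs t ht
    rw [hds] at hs'
    refine hs'.trans (add_le_add_right (hle.trans ?_) δ)
    rw [heq, mul_assoc]
    calc _ ≤ M * ((∫ u in (0 : ℝ)..s, a u * Real.exp (l * A u)) * B) := by gcongr
      _ ≤ M * (Real.exp (l * A s) / 2) := by gcongr
      _ = _ := by ring
  have hl0 : 0 ≤ l := by positivity
  have hMδ : M ≤ 2 * δ := by
    have h1 : 1 ≤ Real.exp (l * A s) := Real.one_le_exp (mul_nonneg hl0 (hA0 s hs))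
    nlinarith
  intro p hp
  refine (hdM p hp).trans ?_
  gcongr
  · linarith
  · exact hAT _ hp.1

/-- A measurable kernel dominated by `a ⊗ b` is integrable against continuous functions. -/
theorem integrableOn_kernel_mul {T : ℝ} {a b : ℝ → ℝ} {q : ℝ → ℝ → ℝ} {g : ℝ × ℝ → ℝ}
    (ha : IntegrableOn a (Icc 0 T)) (hb : IntegrableOn b (Icc 0 T))
    (hq : Measurable (Function.uncurry q))
    (hdom : ∀ᵐ p ∂(volume.restrict (Icc (0 : ℝ) T ×ˢ Icc (0 : ℝ) T)),
      |q p.1 p.2| ≤ a p.1 * b p.2)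
    (hg : ContinuousOn g (Icc 0 T ×ˢ Icc 0 T)) :
    IntegrableOn (fun p : ℝ × ℝ => q p.1 p.2 * g p) (Icc 0 T ×ˢ Icc 0 T) := by
  have hab := integrableOn_mul_prod_Icc ha hb
  have hqi : IntegrableOn (fun p : ℝ × ℝ => q p.1 p.2) (Icc 0 T ×ˢ Icc 0 T) :=
    Integrable.mono' hab hq.aestronglyMeasurable hdom
  exact hqi.mul_continuousOn hg (isCompact_Icc.prod isCompact_Icc)

/-- Iterated interval integrals over `[0,s] × [0,t]` as integrals over a rectangle. -/
theorem intervalIntegral_intervalIntegral_eq_setIntegral_prod {s t : ℝ} {f : ℝ × ℝ → ℝ}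
    (hs : 0 ≤ s) (ht : 0 ≤ t) (hf : IntegrableOn f (Ioc 0 s ×ˢ Ioc 0 t)) :
    ∫ u in (0 : ℝ)..s, ∫ v in (0 : ℝ)..t, f (u, v) = ∫ p in Ioc 0 s ×ˢ Ioc 0 t, f p := by
  simp only [intervalIntegral.integral_of_le hs, intervalIntegral.integral_of_le ht]
  exact (setIntegral_prod f hf).symm

/-- **stability.** If the kernels `qₙ` and `q` are measurable, dominated a.e.
by `a(u)b(v)` with `a, b ≥ 0` integrable, and `∫₀^T∫₀^T |qₙ − q| → 0`, then the bounded
continuous Goursat–Volterra solutions `kₙ` converge uniformly on `[0,T]²` to `k`. -/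
theorem stmt11 {T : ℝ} (hT : 0 < T) (a b : ℝ → ℝ)
    (ha0 : ∀ u ∈ Icc (0 : ℝ) T, 0 ≤ a u) (hb0 : ∀ v ∈ Icc (0 : ℝ) T, 0 ≤ b v)
    (ha : IntegrableOn a (Icc 0 T)) (hb : IntegrableOn b (Icc 0 T))
    (qn : ℕ → ℝ → ℝ → ℝ) (q : ℝ → ℝ → ℝ)
    (hqn : ∀ n, Measurable (Function.uncurry (qn n)))
    (hq : Measurable (Function.uncurry q))
    (hdomn : ∀ n, ∀ᵐ p ∂(volume.restrict (Icc (0 : ℝ) T ×ˢ Icc (0 : ℝ) T)),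
      |qn n p.1 p.2| ≤ a p.1 * b p.2)
    (hdom : ∀ᵐ p ∂(volume.restrict (Icc (0 : ℝ) T ×ˢ Icc (0 : ℝ) T)),
      |q p.1 p.2| ≤ a p.1 * b p.2)
    (hL1 : Tendsto (fun n => ∫ u in (0 : ℝ)..T, ∫ v in (0 : ℝ)..T, |qn n u v - q u v|)
      atTop (nhds 0))
    (kn : ℕ → ℝ → ℝ → ℝ) (k : ℝ → ℝ → ℝ)
    (hkn : ∀ n, IsGoursatSolution T (qn n) (kn n)) (hk : IsGoursatSolution T q k) :
    TendstoUniformlyOn (fun n (p : ℝ × ℝ) => kn n p.1 p.2) (fun p : ℝ × ℝ => k p.1 p.2)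
      atTop (Icc 0 T ×ˢ Icc 0 T) := by
  have hT0 := hT.le
  have hsub : ∀ s ∈ Icc (0 : ℝ) T, ∀ t ∈ Icc (0 : ℝ) T,
      Ioc 0 s ×ˢ Ioc 0 t ⊆ Icc (0 : ℝ) T ×ˢ Icc (0 : ℝ) T := fun s hs t ht =>
    prod_mono (fun u hu => ⟨hu.1.le, hu.2.trans hs.2⟩) fun u hu => ⟨hu.1.le, hu.2.trans ht.2⟩
  have hTT : T ∈ Icc (0 : ℝ) T := ⟨hT0, le_rfl⟩
  obtain ⟨hkc, ⟨C, hC⟩, hkeq⟩ := hk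
  have hC0 : 0 ≤ C := (abs_nonneg _).trans (hC T hTT T hTT)
  set E : ℝ := Real.exp ((2 * (∫ v in (0 : ℝ)..T, b v) + 1) * ∫ u in (0 : ℝ)..T, a u)
  set ε : ℕ → ℝ := fun n => ∫ u in (0 : ℝ)..T, ∫ v in (0 : ℝ)..T, |qn n u v - q u v|
  have hbound : ∀ n, ∀ p ∈ Icc (0 : ℝ) T ×ˢ Icc (0 : ℝ) T,
      |kn n p.1 p.2 - k p.1 p.2| ≤ 2 * (ε n * C) * E := by
    intro n
    obtain ⟨hknc, -, hkneq⟩ := hkn n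
    have hdc : ContinuousOn (fun p : ℝ × ℝ => kn n p.1 p.2 - k p.1 p.2) (Icc 0 T ×ˢ Icc 0 T) :=
      hknc.sub hkc
    refine abs_le_of_abs_le_add_setIntegral_prod hT0 ha0 hb0 ha hb hdc fun s hs t ht => ?_
    have hR := hsub s hs t ht
    have hRm : MeasurableSet (Ioc 0 s ×ˢ Ioc (0 : ℝ) t) := measurableSet_Ioc.prod measurableSet_Ioc
    have i1 := (integrableOn_kernel_mul ha hb (hqn n) (hdomn n) hknc).mono_set hR
    have i2 := (integrableOn_kernel_mul ha hb hq hdom hkc).mono_set hR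
    have i3 := (integrableOn_kernel_mul ha hb (hqn n) (hdomn n) hkc).mono_set hR
    have i4 := integrableOn_kernel_mul ha hb (hqn n) (hdomn n) hdc
    have i5 : IntegrableOn (fun p : ℝ × ℝ => |qn n p.1 p.2 - q p.1 p.2|)
        (Icc 0 T ×ˢ Icc 0 T) := by
      have j1 := integrableOn_kernel_mul ha hb (hqn n) (hdomn n) (continuousOn_const (c := 1))
      have j2 := integrableOn_kernel_mul ha hb hq hdom (continuousOn_const (c := 1))
      simp only [mul_one] at j1 j2
      exact (j1.sub j2).abs
    have i6 : IntegrableOn (fun p : ℝ × ℝ => a p.1 * b p.2 * |kn n p.1 p.2 - k p.1 p.2|)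
        (Icc 0 T ×ˢ Icc 0 T) :=
      (integrableOn_mul_prod_Icc ha hb).mul_continuousOn hdc.abs
        (isCompact_Icc.prod isCompact_Icc)
    have hε : ε n = ∫ p in Ioc 0 T ×ˢ Ioc 0 T, |qn n p.1 p.2 - q p.1 p.2| :=
      intervalIntegral_intervalIntegral_eq_setIntegral_prod hT0 hT0
        (i5.mono_set (hsub T hTT T hTT))
    have hdiff : kn n s t - k s t =
        (∫ p in Ioc 0 s ×ˢ Ioc 0 t, (qn n p.1 p.2 - q p.1 p.2) * k p.1 p.2) +
          ∫ p in Ioc 0 s ×ˢ Ioc 0 t, qn n p.1 p.2 * (kn n p.1 p.2 - k p.1 p.2) := by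
      have e1 := intervalIntegral_intervalIntegral_eq_setIntegral_prod hs.1 ht.1 i1
      have e2 := intervalIntegral_intervalIntegral_eq_setIntegral_prod hs.1 ht.1 i2
      simp only at e1 e2
      rw [hkneq s hs t ht, hkeq s hs t ht, e1, e2, add_sub_add_left_eq_sub, ← integral_sub i1 i2,
        ← integral_add ((i3.sub i2).congr (.of_forall fun p => (sub_mul _ _ _).symm))
          (i4.mono_set hR)]
      congr 1 with p
      ring
    rw [hdiff]
    refine (abs_add_le _ _).trans (add_le_add ?_ ?_)
    · calc _ ≤ ∫ p in Ioc 0 s ×ˢ Ioc 0 t, |qn n p.1 p.2 - q p.1 p.2| * C := by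
            rw [← Real.norm_eq_abs]
            refine norm_integral_le_of_norm_le ((i5.mono_set hR).mul_const C) ?_
            filter_upwards [ae_restrict_mem hRm] with p hp
            rw [Real.norm_eq_abs, abs_mul]
            gcongr
            exact hC _ (hR hp).1 _ (hR hp).2
        _ = (∫ p in Ioc 0 s ×ˢ Ioc 0 t, |qn n p.1 p.2 - q p.1 p.2|) * C := integral_mul_const _ _
        _ ≤ ε n * C := by
            rw [hε]
            refine mul_le_mul_of_nonneg_right (setIntegral_mono_set (i5.mono_set (hsub T hTT T hTT))
              (.of_forall fun p => abs_nonneg _) (LE.le.eventuallyLE ?_)) hC0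
            exact prod_mono (Ioc_subset_Ioc_right hs.2) (Ioc_subset_Ioc_right ht.2)
    · rw [← Real.norm_eq_abs]
      refine norm_integral_le_of_norm_le (i6.mono_set hR) ?_
      filter_upwards [ae_restrict_of_ae_restrict_of_subset hR (hdomn n)] with p hp
      rw [Real.norm_eq_abs, abs_mul]
      gcongr
  rw [Metric.tendstoUniformlyOn_iff]
  intro r hr
  have hlim : Tendsto (fun n => 2 * (ε n * C) * E) atTop (nhds 0) := by
    simpa using ((hL1.mul_const C).const_mul 2).mul_const E
  filter_upwards [hlim.eventually_lt_const hr] with n hn p hp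
  rw [dist_comm, Real.dist_eq]
  exact (hbound n p hp).trans_lt hn
end
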